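/- arXiv:math/0611006 — 2 statements merged into one kernel-verified Lean document; each statement's English description precedes it below -/
import Mathlib

section
/- Let H be a discrete ω-dimensional poc-set, let Σ be an almost-equality class of H°, and let a, b ∈ H both be transverse to Σ (i.e., S_a ∩ Σ, S_{a*} ∩ Σ, S_b ∩ Σ, S_{b*} ∩ Σ are all nonempty). Then S_a ∩ Σ ⊆ S_b ∩ Σ holds if and only if a ≤ b. -/
universe u

/-- A poc-set: a partially ordered set with minimum `zero` and an order-reversing
involution `star` such that `h ≤ star h` implies `h = zero`. -/
structure PocSet (H : Type u) [PartialOrder H] : Type u where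
  star : H → H
  zero : H
  zero_le : ∀ h : H, zero ≤ h
  star_star : ∀ h : H, star (star h) = h
  star_antitone : ∀ a b : H, a ≤ b → star b ≤ star a
  eq_zero_of_le_star : ∀ h : H, h ≤ star h → h = zero

namespace PocSet

variable {H : Type u} [PartialOrder H]

/-- An element is proper if it is neither `0` nor `0*`. -/
def Proper (P : PocSet H) (h : H) : Prop := h ≠ P.zero ∧ h ≠ P.star P.zero

/-- A poc-set is discrete if every interval between proper elements is finite. -/
def IsDiscrete (P : PocSet H) : Prop :=
  ∀ a b : H, P.Proper a → P.Proper b → (Set.Icc a b).Finite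

/-- Two elements are transverse if none of the four nesting relations holds. -/
def Transverse (P : PocSet H) (a b : H) : Prop :=
  ¬ a ≤ b ∧ ¬ P.star a ≤ b ∧ ¬ a ≤ P.star b ∧ ¬ P.star a ≤ P.star b

/-- ω-dimensionality: no infinite subset of pairwise transverse elements. -/
def OmegaDimensional (P : PocSet H) : Prop :=
  ∀ S : Set H, S.Pairwise P.Transverse → S.Finite

/-- Ultrafilter on a poc-set: (UF1) exactly one of `h`, `h*` belongs;
(UF2) no `h ≤ k*` for members `h, k`. -/
def IsUltra (P : PocSet H) (α : Set H) : Prop :=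
  (∀ h : H, h ∈ α ↔ P.star h ∉ α) ∧ ∀ h ∈ α, ∀ k ∈ α, ¬ h ≤ P.star k

/-- An infinite strictly descending chain of elements of `ξ`. -/
def DescChainIn (ξ : Set H) (c : ℕ → H) : Prop :=
  (∀ n, c n ∈ ξ) ∧ ∀ n, c (n + 1) < c n

/-- Principal ultrafilter: an ultrafilter with no infinite strictly descending chain. -/
def IsPrincipal (P : PocSet H) (α : Set H) : Prop :=
  P.IsUltra α ∧ ¬ ∃ c : ℕ → H, DescChainIn α c

/-- The set of minimal elements of `α`. -/
def minset (α : Set H) : Set H := {a ∈ α | ∀ b ∈ α, b ≤ a → b = a}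

/-- Almost equality: both differences are finite. -/
def AlmostEq (α β : Set H) : Prop := (α \ β).Finite ∧ (β \ α).Finite

/-- `Sg` is an almost-equality class of ultrafilters on `P`. -/
def IsAEClass (P : PocSet H) (Sg : Set (Set H)) : Prop :=
  ∃ α : Set H, P.IsUltra α ∧ Sg = {β | P.IsUltra β ∧ AlmostEq α β}

-- The Tychonoff topology on subsets of `H`, induced from the product topology
-- on `H → Bool` (with `Bool` discrete) via characteristic functions.
open Classical in
noncomputable def tychonoff (H : Type u) : TopologicalSpace (Set H) :=
  TopologicalSpace.induced (fun (α : Set H) (h : H) => decide (h ∈ α)) inferInstance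

/-- The median of three subsets of `H`. -/
def med (α β γ : Set H) : Set H := (α ∩ β) ∪ (β ∩ γ) ∪ (α ∩ γ)

end PocSet

open PocSet

open PocSet

namespace PocSet

theorem AlmostEq.symm {H : Type u} {α β : Set H} (h : AlmostEq α β) : AlmostEq β α :=
  ⟨h.2, h.1⟩

theorem AlmostEq.trans {H : Type u} {α β γ : Set H} (h₁ : AlmostEq α β) (h₂ : AlmostEq β γ) :
    AlmostEq α γ := by
  refine ⟨(h₁.1.union h₂.1).subset ?_, (h₁.2.union h₂.2).subset ?_⟩ <;>
  · rintro x ⟨hx, hx'⟩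
    by_cases hxβ : x ∈ β <;> simp_all

theorem IsUltra.mem_of_le {H : Type u} [PartialOrder H] {P : PocSet H} {α : Set H}
    (hα : P.IsUltra α) {h k : H} (hh : h ∈ α) (hk : h ≤ k) : k ∈ α := by
  rw [hα.1 k]
  intro hk'
  exact hα.2 h hh _ hk' (by rwa [P.star_star])

theorem le_star_comm {H : Type u} [PartialOrder H] (P : PocSet H) {h k : H}
    (hk : h ≤ P.star k) : k ≤ P.star h := by
  simpa only [P.star_star] using P.star_antitone _ _ hk

theorem star_le_star_iff {H : Type u} [PartialOrder H] (P : PocSet H) {h k : H} :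
    P.star h ≤ P.star k ↔ k ≤ h :=
  ⟨fun hk => by simpa only [P.star_star] using P.star_antitone _ _ hk, P.star_antitone _ _⟩

/-- The ultrafilter obtained from `α` by reversing every member that lies below `star c`. -/
def proj {H : Type u} [PartialOrder H] (P : PocSet H) (α : Set H) (c : H) : Set H :=
  {h | c ≤ h ∨ (h ∈ α ∧ ¬ h ≤ P.star c)}

theorem IsUltra.proj {H : Type u} [PartialOrder H] {P : PocSet H} {α : Set H}
    (hα : P.IsUltra α) {c : H} (hc : ¬ c ≤ P.star c) : P.IsUltra (P.proj α c) := by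
  refine ⟨fun h => ?_, ?_⟩
  · have h₁ := hα.1 h
    have h₂ : P.star h ≤ P.star c ↔ c ≤ h := P.star_le_star_iff
    have h₃ : c ≤ P.star h ↔ h ≤ P.star c := ⟨P.le_star_comm, P.le_star_comm⟩
    have h₄ : ¬ (c ≤ h ∧ h ≤ P.star c) := fun ⟨p, q⟩ => hc (p.trans q)
    simp only [PocSet.proj, Set.mem_ofPred_eq, h₂, h₃]
    tauto
  · rintro h (hh | ⟨hh, hh'⟩) k (hk | ⟨hk, hk'⟩) hle
    · exact hc ((hh.trans hle).trans (P.star_antitone _ _ hk))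
    · exact hk' ((P.le_star_comm hle).trans (P.star_antitone _ _ hh))
    · exact hh' (hle.trans (P.star_antitone _ _ hk))
    · exact hα.2 h hh k hk hle

theorem AlmostEq.proj {H : Type u} [PartialOrder H] {P : PocSet H} {α β : Set H}
    (h : AlmostEq α β) (hβ : P.IsUltra β) {c : H} (hc : c ∈ β) : AlmostEq α (P.proj α c) := by
  refine ⟨h.1.subset ?_, h.2.subset ?_⟩
  · rintro x ⟨hx, hx'⟩
    refine ⟨hx, fun hxβ => hx' (Or.inr ⟨hx, hβ.2 x hxβ c hc⟩)⟩
  · rintro x ⟨hx | hx, hx'⟩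
    · exact ⟨hβ.mem_of_le hc hx, hx'⟩
    · exact absurd hx.1 hx'

end PocSet

theorem stmt8 {H : Type u} [PartialOrder H] (P : PocSet H)
    (hdisc : P.IsDiscrete) (homega : P.OmegaDimensional)
    (Sg : Set (Set H)) (hSg : IsAEClass P Sg) (a b : H)
    (hta : (∃ α ∈ Sg, a ∈ α) ∧ (∃ α ∈ Sg, P.star a ∈ α))
    (htb : (∃ α ∈ Sg, b ∈ α) ∧ (∃ α ∈ Sg, P.star b ∈ α)) :
    (∀ α ∈ Sg, a ∈ α → b ∈ α) ↔ a ≤ b := by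
  obtain ⟨α₀, -, rfl⟩ := hSg
  obtain ⟨α, ⟨hα, hα₀⟩, ha⟩ := hta.1
  obtain ⟨β, ⟨hβ, hβ₀⟩, hb⟩ := htb.2
  refine ⟨fun hab => ?_, fun hab γ hγ haγ => hγ.1.mem_of_le haγ hab⟩
  by_contra hle
  have hult := hα.proj (hβ.2 _ hb _ hb)
  have hbmem := hab (P.proj α (P.star b))
    ⟨hult, hα₀.trans ((hα₀.symm.trans hβ₀).proj hβ hb)⟩
    (Or.inr ⟨ha, by rwa [P.star_star]⟩)
  exact (hult.1 b).1 hbmem (Or.inl le_rfl)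
end

section
/- Let H be a discrete ω-dimensional poc-set and let Ξ, Σ be almost-equality classes of H°. If Ξ intersects the Tychonoff closure of Σ, then Ξ is entirely contained in the Tychonoff closure of Σ. -/
universe u

open PocSet

open PocSet

namespace PocSet

variable {H : Type u} [PartialOrder H]

theorem mem_closure_tychonoff_iff {H : Type*} (S : Set (Set H)) (X : Set H) :
    X ∈ @closure _ (tychonoff H) S ↔ ∀ F : Finset H, ∃ σ ∈ S, ∀ h ∈ F, h ∈ σ ↔ h ∈ X := by
  classical
  let _ : TopologicalSpace (Set H) := tychonoff H
  let f : Set H → H → Bool := fun α h => decide (h ∈ α)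
  have hf : Topology.IsInducing f := ⟨rfl⟩
  rw [hf.closure_eq_preimage_closure_image, Set.mem_preimage, mem_closure_iff]
  constructor
  · intro hX F
    obtain ⟨-, hσF, σ, hσ, rfl⟩ := hX ((F : Set H).pi fun h => {f X h})
      (isOpen_set_pi F.finite_toSet fun _ _ => isOpen_discrete _) (fun h _ => rfl)
    exact ⟨σ, hσ, fun h hh => by simpa [f] using hσF h hh⟩
  · intro hX o ho hXo
    obtain ⟨F, u, hu, huo⟩ := isOpen_pi_iff.1 ho _ hXo
    obtain ⟨σ, hσ, hσF⟩ := hX F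
    refine ⟨f σ, huo fun h hh => ?_, σ, hσ, rfl⟩
    have : f σ h = f X h := by simpa [f] using hσF h hh
    rw [this]
    exact (hu h hh).2

theorem star_le_comm (P : PocSet H) {a b : H} (h : P.star a ≤ b) : P.star b ≤ a := by
  simpa [P.star_star] using P.star_antitone _ _ h

theorem le_star_comm_s9 (P : PocSet H) {a b : H} (h : a ≤ P.star b) : b ≤ P.star a := by
  simpa [P.star_star] using P.star_antitone _ _ h

theorem star_le_star_iff_s9 (P : PocSet H) {a b : H} : P.star a ≤ P.star b ↔ b ≤ a :=
  ⟨fun h => by simpa [P.star_star] using P.star_antitone _ _ h, P.star_antitone _ _⟩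

namespace IsUltra

variable {P : PocSet H} {α : Set H}

theorem star_mem_iff (hα : P.IsUltra α) {h : H} : P.star h ∈ α ↔ h ∉ α := by
  rw [hα.1 h, not_not]

theorem mem_of_le_s9 (hα : P.IsUltra α) {a b : H} (ha : a ∈ α) (hab : a ≤ b) : b ∈ α := by
  by_contra hb
  exact hα.2 a ha _ (hα.star_mem_iff.2 hb) (by rwa [P.star_star])

theorem zero_notMem (hα : P.IsUltra α) : P.zero ∉ α :=
  fun h => hα.2 _ h _ h (P.zero_le _)

theorem star_zero_mem (hα : P.IsUltra α) : P.star P.zero ∈ α :=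
  hα.star_mem_iff.2 hα.zero_notMem

theorem proper_of_mem_of_notMem (hα : P.IsUltra α) {β : Set H} (hβ : P.IsUltra β) {a : H}
    (ha : a ∈ α) (ha' : a ∉ β) : P.Proper a :=
  ⟨fun h => hα.zero_notMem (h ▸ ha), fun h => ha' (h ▸ hβ.star_zero_mem)⟩

theorem diff_finite_symm (hα : P.IsUltra α) {β : Set H} (hβ : P.IsUltra β)
    (h : (α \ β).Finite) : (β \ α).Finite :=
  (h.image P.star).subset fun b hb =>
    ⟨P.star b, ⟨hα.star_mem_iff.2 hb.2, fun hb' => hβ.star_mem_iff.1 hb' hb.1⟩, P.star_star b⟩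

end IsUltra

/-- If every element of an infinite family has only finitely many comparable elements in it,
then it contains an infinite antichain. -/
theorem exists_infinite_antichain {T : Set H} (hT : T.Infinite)
    (hfin : ∀ b ∈ T, {h ∈ T | h ≤ b ∨ b ≤ h}.Finite) :
    ∃ M ⊆ T, IsAntichain (· ≤ ·) M ∧ M.Infinite := by
  obtain ⟨M, hM⟩ := zorn_subset {M | M ⊆ T ∧ IsAntichain (· ≤ ·) M} fun c hc hchain =>
    ⟨⋃₀ c, ⟨Set.sUnion_subset fun s hs => (hc hs).1,
      (Set.pairwise_sUnion hchain.directedOn).2 fun s hs => (hc hs).2⟩,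
      fun s hs => Set.subset_sUnion_of_mem hs⟩
  refine ⟨M, hM.prop.1, hM.prop.2, fun hMfin => hT ?_⟩
  refine (hMfin.biUnion fun b hb => hfin b (hM.prop.1 hb)).subset fun t ht => ?_
  by_contra hcon
  simp only [Set.mem_iUnion, Set.mem_ofPred_eq, not_exists, not_and, not_or] at hcon
  have hanti : IsAntichain (· ≤ ·) (insert t M) :=
    hM.prop.2.insert (fun b hb _ => (hcon b hb ht).2) (fun b hb _ => (hcon b hb ht).1)
  have htM : t ∈ M :=
    hM.le_of_ge ⟨Set.insert_subset ht hM.prop.1, hanti⟩ (Set.subset_insert t M)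
      (Set.mem_insert t M)
  exact (hcon t htM ht).1 le_rfl

theorem transverse_of_mem {P : PocSet H} {σ : Set H} (hσ : P.IsUltra σ) {a h k : H}
    (ha : P.Proper a) (hh : h ∈ σ) (hk : k ∈ σ) (hha : h ≤ a) (hka : k ≤ a)
    (hhk : ¬ h ≤ k) (hkh : ¬ k ≤ h) : P.Transverse h k := by
  refine ⟨hhk, fun hle => ha.2 ?_, hσ.2 h hh k hk, fun hle => hkh (P.star_le_star_iff_s9.1 hle)⟩
  have : P.star a ≤ P.star (P.star a) := by
    rw [P.star_star]
    exact (P.star_antitone _ _ hha).trans (hle.trans hka)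
  rw [← P.eq_zero_of_le_star _ this, P.star_star]

/-- An infinite set of elements of `σ` below a proper `a` has an element lying above infinitely
many elements of `σ`. -/
theorem exists_infinite_below {P : PocSet H} (hdisc : P.IsDiscrete)
    (homega : P.OmegaDimensional) {σ : Set H} (hσ : P.IsUltra σ) {a : H} (ha : P.Proper a)
    {T : Set H} (hTσ : T ⊆ σ) (hTa : ∀ h ∈ T, h ≤ a) (hT : T.Infinite) :
    ∃ b ∈ T, {h ∈ σ | h ≤ b}.Infinite := by
  by_contra! hcon
  have hproper : ∀ b ∈ T, P.Proper b := fun b hb =>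
    ⟨fun h => hσ.zero_notMem (h ▸ hTσ hb), fun h => ha.2 (le_antisymm
      (P.le_star_comm_s9 (P.zero_le _)) (h ▸ hTa b hb))⟩
  obtain ⟨M, hMT, hM, hMinf⟩ := exists_infinite_antichain hT fun b hb =>
    ((hcon b hb).union (hdisc b a (hproper b hb) ha)).subset
      fun h hh => hh.2.imp (fun hhb => ⟨hTσ hh.1, hhb⟩) fun hbh => ⟨hbh, hTa h hh.1⟩
  exact hMinf <| homega M fun h hh k hk hne =>
    transverse_of_mem hσ ha (hTσ (hMT hh)) (hTσ (hMT hk)) (hTa h (hMT hh)) (hTa k (hMT hk))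
      (hM hh hk hne) (hM hk hh hne.symm)

/-- The set `σ` with the elements of `L` replaced by their complements. -/
def flipOn (P : PocSet H) (L σ : Set H) : Set H := {h | (h ∈ σ ∧ h ∉ L) ∨ P.star h ∈ L}

theorem isUltra_flipOn {P : PocSet H} {L σ : Set H} (hσ : P.IsUltra σ) (hL : IsLowerSet L)
    (hLL : ∀ h ∈ L, ∀ k ∈ L, ¬ P.star h ≤ k) : P.IsUltra (P.flipOn L σ) := by
  constructor
  · intro h
    have h1 : P.star h ∈ L → h ∉ L := fun h1 h2 => hLL h h2 _ h1 le_rfl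
    simp only [flipOn, Set.mem_ofPred_eq, P.star_star, hσ.star_mem_iff]
    tauto
  · rintro h (⟨hh, hhL⟩ | hh) k (⟨hk, hkL⟩ | hk) hle
    · exact hσ.2 h hh k hk hle
    · exact hhL (hL hle hk)
    · exact hkL (hL (P.le_star_comm_s9 hle) hh)
    · exact hLL _ hh _ hk (by rwa [P.star_star])

theorem flipOn_lowerClosure_diff {P : PocSet H} {ξ ξ' : Set H} (hξ : P.IsUltra ξ)
    (hξ' : P.IsUltra ξ') : P.flipOn (lowerClosure (ξ \ ξ')) ξ = ξ' := by
  ext h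
  simp only [flipOn, Set.mem_ofPred_eq, SetLike.mem_coe, mem_lowerClosure]
  constructor
  · rintro (⟨hh, hL⟩ | ⟨d, hd, hle⟩)
    · by_contra hh'
      exact hL ⟨h, ⟨hh, hh'⟩, le_rfl⟩
    · exact hξ'.mem_of_le_s9 (hξ'.star_mem_iff.2 hd.2) (P.star_le_comm hle)
  · intro hh'
    by_cases hh : h ∈ ξ
    · exact .inl ⟨hh, fun ⟨d, hd, hle⟩ => hd.2 (hξ'.mem_of_le_s9 hh' hle)⟩
    · exact .inr ⟨_, ⟨hξ.star_mem_iff.2 hh, fun h1 => hξ'.star_mem_iff.1 h1 hh'⟩, le_rfl⟩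

theorem AlmostEq.diff_finite {G : Type*} {α β γ : Set G} (hβ : AlmostEq α β) (hγ : AlmostEq α γ) :
    (β \ γ).Finite :=
  (hβ.2.union hγ.1).subset fun h hh => by
    by_cases h' : h ∈ α
    · exact .inr ⟨h', hh.2⟩
    · exact .inl ⟨hh.1, h'⟩

theorem finite_inter_lowerClosure_diff {P : PocSet H} (hdisc : P.IsDiscrete)
    (homega : P.OmegaDimensional) {ξ ξ' σ : Set H} {Sg : Set (Set H)} (hξ : P.IsUltra ξ)
    (hξ' : P.IsUltra ξ') (hσ : P.IsUltra σ) (hD : (ξ \ ξ').Finite)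
    (hSg : ∀ τ ∈ Sg, P.IsUltra τ ∧ (σ \ τ).Finite) (hcl : ξ ∈ @closure _ (tychonoff H) Sg) :
    (σ ∩ lowerClosure (ξ \ ξ')).Finite := by
  suffices h : ∀ a ∈ ξ \ ξ', {h ∈ σ | h ≤ a}.Finite by
    refine (hD.biUnion h).subset fun x hx => ?_
    obtain ⟨d, hd, hle⟩ := mem_lowerClosure.1 hx.2
    exact Set.mem_biUnion hd ⟨hx.1, hle⟩
  intro a ha
  by_contra hinf
  have hT : ({h ∈ σ | h ≤ a} \ (ξ \ ξ')).Infinite := Set.Infinite.sdiff hinf hD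
  obtain ⟨b, hb, hbinf⟩ := exists_infinite_below hdisc homega hσ
    (hξ.proper_of_mem_of_notMem hξ' ha.1 ha.2) (fun h hh => hh.1.1) (fun h hh => hh.1.2) hT
  have hbξ : b ∉ ξ := fun h => hb.2 ⟨h, fun h' => ha.2 (hξ'.mem_of_le_s9 h' hb.1.2)⟩
  obtain ⟨τ, hτ, hbτ⟩ := (mem_closure_tychonoff_iff Sg ξ).1 hcl {b}
  have hbτ : b ∉ τ := fun h => hbξ ((hbτ b (Finset.mem_singleton_self b)).1 h)
  exact hbinf ((hSg τ hτ).2.subset fun h hh =>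
    ⟨hh.1, fun h' => hbτ ((hSg τ hτ).1.mem_of_le_s9 h' hh.2)⟩)

end PocSet

theorem stmt9 {H : Type u} [PartialOrder H] (P : PocSet H)
    (hdisc : P.IsDiscrete) (homega : P.OmegaDimensional)
    (Xi Sg : Set (Set H)) (hXi : IsAEClass P Xi) (hSg : IsAEClass P Sg) :
    (letI : TopologicalSpace (Set H) := tychonoff H
     (Xi ∩ closure Sg).Nonempty → Xi ⊆ closure Sg) := by
  rintro ⟨ξ, hξXi, hcl⟩ ξ' hξ'Xi
  obtain ⟨α, -, rfl⟩ := hXi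
  obtain ⟨β, -, rfl⟩ := hSg
  obtain ⟨hξ, hαξ⟩ := hξXi
  obtain ⟨hξ', hαξ'⟩ := hξ'Xi
  rw [mem_closure_tychonoff_iff]
  intro F
  obtain ⟨σ, ⟨hσ, hβσ⟩, hσF⟩ := (mem_closure_tychonoff_iff _ ξ).1 hcl F
  let L : Set H := ↑(lowerClosure (ξ \ ξ'))
  have hult : P.IsUltra (P.flipOn L σ) := by
    refine isUltra_flipOn hσ (lowerClosure (ξ \ ξ')).lower fun h hh k hk hle => ?_
    obtain ⟨d, hd, hhd⟩ := mem_lowerClosure.1 hh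
    obtain ⟨e, he, hke⟩ := mem_lowerClosure.1 hk
    exact he.2 (hξ'.mem_of_le_s9 (hξ'.star_mem_iff.2 hd.2)
      ((P.star_antitone _ _ hhd).trans (hle.trans hke)))
  have hdiff : (σ \ P.flipOn L σ).Finite :=
    (finite_inter_lowerClosure_diff hdisc homega hξ hξ' hσ (hαξ.diff_finite hαξ')
      (fun τ hτ => ⟨hτ.1, hβσ.diff_finite hτ.2⟩) hcl).subset
      fun h hh => ⟨hh.1, by_contra fun h' => hh.2 (.inl ⟨hh.1, h'⟩)⟩
  have hdiff' := hσ.diff_finite_symm hult hdiff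
  refine ⟨P.flipOn L σ, ⟨hult, ?_, ?_⟩, fun h hh => ?_⟩
  · refine (hβσ.1.union hdiff).subset fun h hh => ?_
    by_cases h' : h ∈ σ
    exacts [.inr ⟨h', hh.2⟩, .inl ⟨hh.1, h'⟩]
  · refine (hdiff'.union hβσ.2).subset fun h hh => ?_
    by_cases h' : h ∈ σ
    exacts [.inr ⟨h', hh.2⟩, .inl ⟨hh.1, h'⟩]
  · conv_rhs => rw [← flipOn_lowerClosure_diff hξ hξ']
    simp only [flipOn, Set.mem_ofPred_eq, hσF h hh, L]
end
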